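/- Reduction of cumulative utility over a play horizon (Proposition 1): for every T : ℕ and every sequence of true follower types t : Fin T → Fin K, sSup {∑ s : Fin T, V π (ψ (t s) π) (t s) | π ∈ Π} = sSup {∑ s : Fin T, V π (ψ (t s) π) (t s) | π ∈ Π̂}. -/

import Mathlib

open Finset Set

attribute [local instance] Classical.propDecidable

noncomputable section

variable {M N K : ℕ}

/-- The belief space `Ξ` is the standard simplex; the best-response region `Ξ[θ,j]` consists of
the beliefs under which `j` is a best response for the type-`θ` follower. -/
def XiBR (F : Fin K → Fin M → Fin N → ℝ) (θ : Fin K) (j : Fin N) : Set (Fin M → ℝ) :=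
  {b | b ∈ stdSimplex ℝ (Fin M) ∧ ∀ j' : Fin N, ∑ i, b i * F θ i j' ≤ ∑ i, b i * F θ i j}

/-- The region `Ξ[𝐣] = ⋂ θ, Ξ[θ, 𝐣 θ]`. -/
def XiT (F : Fin K → Fin M → Fin N → ℝ) (js : Fin K → Fin N) : Set (Fin M → ℝ) :=
  ⋂ θ : Fin K, XiBR F θ (js θ)

/-- The follower's value function `F̄ θ b = max_j ∑ i, b i * F θ i j`. -/
def Fbar (F : Fin K → Fin M → Fin N → ℝ) (θ : Fin K) (b : Fin M → ℝ) : ℝ :=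
  ⨆ j : Fin N, ∑ i, b i * F θ i j

/-- The leader's (leader-favored tie-broken) value function `V̄ θ b`: the maximum of
`∑ i, b i * L i j` over the follower best responses `j` at belief `b`. -/
def Vbar (L : Fin M → Fin N → ℝ) (F : Fin K → Fin M → Fin N → ℝ) (θ : Fin K)
    (b : Fin M → ℝ) : ℝ :=
  sSup ((fun j => ∑ i, b i * L i j) '' {j : Fin N | ∑ i, b i * F θ i j = Fbar F θ b})

/-- The set of beliefs `Ξ̂`: the union over tuples `𝐣` of the extreme points of `Ξ[𝐣]`. -/
def XiHat (F : Fin K → Fin M → Fin N → ℝ) : Set (Fin M → ℝ) :=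
  ⋃ js : Fin K → Fin N, Set.extremePoints ℝ (XiT F js)

/-- A signaling assigns to each type a nonnegative finitely supported weight function on
beliefs, supported in the simplex, of total mass one. -/
def IsSignaling (π : Fin K → ((Fin M → ℝ) →₀ ℝ)) : Prop :=
  ∀ θ : Fin K, (∀ b, 0 ≤ π θ b) ∧ (((π θ).support : Set (Fin M → ℝ)) ⊆ stdSimplex ℝ (Fin M)) ∧
    ∑ b ∈ (π θ).support, π θ b = 1

/-- Consistency: all types' expected posterior beliefs coincide. -/
def Consistent (π : Fin K → ((Fin M → ℝ) →₀ ℝ)) : Prop :=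
  ∀ θ θ' : Fin K, ∀ i : Fin M,
    ∑ b ∈ (π θ).support, π θ b * b i = ∑ b ∈ (π θ').support, π θ' b * b i

/-- The set `Π` of consistent signalings. -/
def SigSet (M K : ℕ) : Set (Fin K → ((Fin M → ℝ) →₀ ℝ)) :=
  {π | IsSignaling π ∧ Consistent π}

/-- The set `Π̂` of consistent signalings supported on `Ξ̂`. -/
def SigSetHat (F : Fin K → Fin M → Fin N → ℝ) : Set (Fin K → ((Fin M → ℝ) →₀ ℝ)) :=
  {π | π ∈ SigSet M K ∧ ∀ θ, ((π θ).support : Set (Fin M → ℝ)) ⊆ XiHat F}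

/-- The follower's expected utility `U π θ̂ θ`. -/
def Usig (F : Fin K → Fin M → Fin N → ℝ) (π : Fin K → ((Fin M → ℝ) →₀ ℝ))
    (θhat θ : Fin K) : ℝ :=
  ∑ b ∈ (π θhat).support, π θhat b * Fbar F θ b

/-- The leader's expected utility `V π θ̂ θ`. -/
def Vsig (L : Fin M → Fin N → ℝ) (F : Fin K → Fin M → Fin N → ℝ)
    (π : Fin K → ((Fin M → ℝ) →₀ ℝ)) (θhat θ : Fin K) : ℝ :=
  ∑ b ∈ (π θhat).support, π θhat b * Vbar L F θ b

/-- The follower's optimal reporting strategy `ψ θ π`: the least maximizer of `U π · θ`. -/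
def psi (F : Fin K → Fin M → Fin N → ℝ) (π : Fin K → ((Fin M → ℝ) →₀ ℝ)) (θ : Fin K) :
    Fin K :=
  if h : (Finset.univ.filter fun θhat => ∀ β, Usig F π β θ ≤ Usig F π θhat θ).Nonempty then
    (Finset.univ.filter fun θhat => ∀ β, Usig F π β θ ≤ Usig F π θhat θ).min' h
  else θ

/-- The leader's expected utility `V^μ` under prior `μ`. -/
def Vmu (L : Fin M → Fin N → ℝ) (F : Fin K → Fin M → Fin N → ℝ) (μ : Fin K → ℝ)
    (π : Fin K → ((Fin M → ℝ) →₀ ℝ)) : ℝ :=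
  ∑ θ, μ θ * Vsig L F π (psi F π θ) θ

theorem finite_extremePoints_of_linear_inequalities {E ι : Type*} [AddCommGroup E] [Module ℝ E]
    [Finite ι] (g : ι → E →ₗ[ℝ] ℝ) (a : ι → ℝ) (l : E →ₗ[ℝ] ℝ) (r : ℝ) :
    (extremePoints ℝ {x | (∀ c, g c x ≤ a c) ∧ l x = r}).Finite := by
  refine Set.Finite.of_finite_image (f := fun x => {c | g c x = a c}) (Set.toFinite _) ?_
  intro x hx y hy hxy
  obtain ⟨hxA, hx⟩ := mem_extremePoints_iff_left.1 hx
  have hyA := (mem_extremePoints_iff_left.1 hy).1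
  have hnear : ∀ᶠ s in nhdsWithin (0 : ℝ) (Set.Ioi 0),
      ∀ c, g c x + s * (g c x - g c y) ≤ a c := by
    refine Filter.eventually_all.2 fun c => ?_
    by_cases hc : g c x = a c
    · have hcy : g c y = a c := (Set.ext_iff.1 hxy c).1 hc
      simp [hc, hcy]
    · have hcont : Continuous fun s : ℝ => g c x + s * (g c x - g c y) := by fun_prop
      have hlt : g c x + 0 * (g c x - g c y) < a c := by
        simpa using lt_of_le_of_ne (hxA.1 c) hc
      exact Filter.Eventually.filter_mono nhdsWithin_le_nhds
        ((hcont.continuousAt.eventually_lt_const hlt).mono fun _ h => h.le)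
  obtain ⟨s, hs, hs0⟩ := (hnear.and self_mem_nhdsWithin).exists
  replace hs0 : 0 < s := hs0
  symm
  refine hx y hyA (x + s • (x - y)) ⟨fun c => by simpa using hs c, ?_⟩
    ⟨s / (1 + s), 1 / (1 + s), by positivity, by positivity, by field_simp; ring, ?_⟩
  · simp [hxA.2, hyA.2]
  · match_scalars <;> field_simp; ring

theorem mem_XiT {F : Fin K → Fin M → Fin N → ℝ} {js : Fin K → Fin N} {b : Fin M → ℝ}
    (hK : 0 < K) :
    b ∈ XiT F js ↔ b ∈ stdSimplex ℝ (Fin M) ∧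
      ∀ θ j', ∑ i, b i * F θ i j' ≤ ∑ i, b i * F θ i (js θ) := by
  simp only [XiT, XiBR, Set.mem_iInter, Set.mem_ofPred_eq]
  exact ⟨fun h => ⟨(h ⟨0, hK⟩).1, fun θ => (h θ).2⟩, fun h θ => ⟨h.1, h.2 θ⟩⟩

theorem isCompact_XiT (hK : 0 < K) (F : Fin K → Fin M → Fin N → ℝ) (js : Fin K → Fin N) :
    IsCompact (XiT F js) := by
  refine (isCompact_stdSimplex ℝ (Fin M)).of_isClosed_subset ?_ fun b hb => ((mem_XiT hK).1 hb).1
  refine isClosed_iInter fun θ => ?_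
  have h : XiBR F θ (js θ) = stdSimplex ℝ (Fin M) ∩
      ⋂ j', {b | ∑ i, b i * F θ i j' ≤ ∑ i, b i * F θ i (js θ)} := by
    ext b
    simp [XiBR]
  rw [h]
  exact (isClosed_stdSimplex ℝ (Fin M)).inter
    (isClosed_iInter fun j' => isClosed_le (by fun_prop) (by fun_prop))

theorem convex_XiT (F : Fin K → Fin M → Fin N → ℝ) (js : Fin K → Fin N) :
    Convex ℝ (XiT F js) := by
  refine convex_iInter fun θ => ?_
  intro x hx y hy p q hp hq hpq
  refine ⟨convex_stdSimplex ℝ (Fin M) hx.1 hy.1 hp hq hpq, fun j' => ?_⟩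
  have := add_le_add (mul_le_mul_of_nonneg_left (hx.2 j') hp)
    (mul_le_mul_of_nonneg_left (hy.2 j') hq)
  simpa [add_mul, Finset.sum_add_distrib, Finset.mul_sum, mul_assoc] using this

/-- The pairing of beliefs with a vector, as a linear functional. -/
def pairing (v : Fin M → ℝ) : (Fin M → ℝ) →ₗ[ℝ] ℝ :=
  ∑ i, v i • LinearMap.proj i

@[simp]
theorem pairing_apply (v b : Fin M → ℝ) : pairing v b = ∑ i, b i * v i := by
  simp [pairing, mul_comm]

theorem finite_extremePoints_XiT (hK : 0 < K) (F : Fin K → Fin M → Fin N → ℝ)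
    (js : Fin K → Fin N) : (extremePoints ℝ (XiT F js)).Finite := by
  have h := finite_extremePoints_of_linear_inequalities
    (Sum.elim (fun i : Fin M => -LinearMap.proj i)
      (fun c : Fin K × Fin N => pairing (fun i => F c.1 i c.2) -
        pairing (fun i => F c.1 i (js c.1)))) (fun _ => 0)
    (pairing (fun _ : Fin M => 1)) 1
  refine (congrArg (fun A => (extremePoints ℝ A).Finite) (Set.ext fun b => ?_)).mpr h
  rw [mem_XiT hK]
  simp [stdSimplex, Sum.forall]
  tauto

theorem convexHull_extremePoints_XiT (hK : 0 < K) (F : Fin K → Fin M → Fin N → ℝ)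
    (js : Fin K → Fin N) : convexHull ℝ (extremePoints ℝ (XiT F js)) = XiT F js := by
  rw [← ((finite_extremePoints_XiT hK F js).isClosed_convexHull ℝ).closure_eq]
  exact closure_convexHull_extremePoints (isCompact_XiT hK F js) (convex_XiT F js)

theorem Fbar_eq_of_forall_le {F : Fin K → Fin M → Fin N → ℝ} {θ : Fin K} {j : Fin N}
    {b : Fin M → ℝ} (h : ∀ j', ∑ i, b i * F θ i j' ≤ ∑ i, b i * F θ i j) :
    Fbar F θ b = ∑ i, b i * F θ i j :=
  have : Nonempty (Fin N) := ⟨j⟩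
  le_antisymm (ciSup_le h)
    (le_ciSup (f := fun j => ∑ i, b i * F θ i j) (Set.finite_range _).bddAbove j)

theorem le_Vbar (L : Fin M → Fin N → ℝ) {F : Fin K → Fin M → Fin N → ℝ} {θ : Fin K} {j : Fin N}
    {b : Fin M → ℝ} (h : Fbar F θ b = ∑ i, b i * F θ i j) :
    ∑ i, b i * L i j ≤ Vbar L F θ b :=
  le_csSup (Set.toFinite _).bddAbove ⟨j, h.symm, rfl⟩

theorem exists_best_response (hN : 0 < N) (L : Fin M → Fin N → ℝ) (F : Fin K → Fin M → Fin N → ℝ)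
    (θ : Fin K) (b : Fin M → ℝ) :
    ∃ j, (∀ j', ∑ i, b i * F θ i j' ≤ ∑ i, b i * F θ i j) ∧ Vbar L F θ b = ∑ i, b i * L i j := by
  have : Nonempty (Fin N) := ⟨⟨0, hN⟩⟩
  obtain ⟨j₀, hj₀⟩ := exists_eq_ciSup_of_finite (f := fun j => ∑ i, b i * F θ i j)
  have hne : ((fun j => ∑ i, b i * L i j) '' {j | ∑ i, b i * F θ i j = Fbar F θ b}).Nonempty :=
    ⟨_, j₀, hj₀, rfl⟩
  obtain ⟨j, hj, hjV⟩ := hne.csSup_mem (Set.toFinite _)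
  replace hj : ∑ i, b i * F θ i j = Fbar F θ b := hj
  exact ⟨j, fun j' => (le_ciSup (f := fun j => ∑ i, b i * F θ i j)
    (Set.finite_range _).bddAbove j').trans_eq hj.symm, hjV.symm⟩

/-- Every belief splits into extreme beliefs without changing any follower's value and without
lowering the leader's value. -/
theorem exists_splitting (hN : 0 < N) (hK : 0 < K) (L : Fin M → Fin N → ℝ)
    (F : Fin K → Fin M → Fin N → ℝ) {b : Fin M → ℝ} (hb : b ∈ stdSimplex ℝ (Fin M)) :
    ∃ w : (Fin M → ℝ) →₀ ℝ, 0 ≤ w ∧ (w.support : Set (Fin M → ℝ)) ⊆ XiHat F ∧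
      Finsupp.linearCombination ℝ (fun _ => (1 : ℝ)) w = 1 ∧
      (∀ i, Finsupp.linearCombination ℝ (fun e : Fin M → ℝ => e i) w = b i) ∧
      (∀ θ, Finsupp.linearCombination ℝ (Fbar F θ) w = Fbar F θ b) ∧
      ∀ θ, Vbar L F θ b ≤ Finsupp.linearCombination ℝ (Vbar L F θ) w := by
  choose js hjs hV using fun θ => exists_best_response hN L F θ b
  have hmem : b ∈ convexHull ℝ (extremePoints ℝ (XiT F js)) := by
    rw [convexHull_extremePoints_XiT hK]
    exact (mem_XiT hK).2 ⟨hb, hjs⟩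
  have hfin := finite_extremePoints_XiT hK F js
  rw [← hfin.coe_toFinset, Finset.mem_convexHull'] at hmem
  obtain ⟨w, hw0, hw1, hwb⟩ := hmem
  have hlin (φ : (Fin M → ℝ) →ₗ[ℝ] ℝ) : ∑ e ∈ hfin.toFinset, w e * φ e = φ b := by
    simp [← hwb]
  have hF (θ : Fin K) (e) (he : e ∈ hfin.toFinset) : Fbar F θ e = ∑ i, e i * F θ i (js θ) :=
    Fbar_eq_of_forall_le
      (((mem_XiT hK).1 (extremePoints_subset (hfin.mem_toFinset.1 he))).2 θ)
  have hcomb (f : (Fin M → ℝ) → ℝ) :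
      Finsupp.linearCombination ℝ f (∑ e ∈ hfin.toFinset, Finsupp.single e (w e)) =
        ∑ e ∈ hfin.toFinset, w e * f e := by
    simp
  refine ⟨∑ e ∈ hfin.toFinset, Finsupp.single e (w e),
    Finset.sum_nonneg fun e he => Finsupp.single_nonneg.2 (hw0 e he), ?_, ?_, ?_, ?_, ?_⟩
  · intro x hx
    obtain ⟨e, he, hxe⟩ := Finset.mem_biUnion.1 (Finsupp.support_finsetSum hx)
    obtain rfl := Finset.mem_singleton.1 (Finsupp.support_single_subset hxe)
    exact Set.mem_iUnion.2 ⟨js, hfin.mem_toFinset.1 he⟩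
  · rw [hcomb]
    simpa using hw1
  · intro i
    rw [hcomb]
    exact hlin (LinearMap.proj i)
  · intro θ
    rw [hcomb, Fbar_eq_of_forall_le (hjs θ), ← pairing_apply, ← hlin]
    exact Finset.sum_congr rfl fun e he => by rw [hF θ e he, pairing_apply]
  · intro θ
    rw [hcomb, hV θ, ← pairing_apply, ← hlin]
    refine Finset.sum_le_sum fun e he => mul_le_mul_of_nonneg_left ?_ (hw0 e he)
    rw [pairing_apply]
    exact le_Vbar L (hF θ e he)

theorem psi_congr {F : Fin K → Fin M → Fin N → ℝ} {π ρ : Fin K → ((Fin M → ℝ) →₀ ℝ)}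
    (h : Usig F π = Usig F ρ) : psi F π = psi F ρ := by
  unfold psi
  rw [h]

theorem exists_hat_signaling (hN : 0 < N) (hK : 0 < K) (L : Fin M → Fin N → ℝ)
    (F : Fin K → Fin M → Fin N → ℝ) {π : Fin K → ((Fin M → ℝ) →₀ ℝ)} (hπ : π ∈ SigSet M K) :
    ∃ ρ ∈ SigSetHat F, Usig F π = Usig F ρ ∧ ∀ θhat θ, Vsig L F π θhat θ ≤ Vsig L F ρ θhat θ := by
  have hsplit (b : Fin M → ℝ) := fun hb => exists_splitting (b := b) hN hK L F hb
  choose! W hW0 hWsupp hW1 hWmean hWF hWV using hsplit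
  obtain ⟨hsig, hcons⟩ := hπ
  have hcomb (f : (Fin M → ℝ) → ℝ) (θ : Fin K) :
      ∑ e ∈ (Finsupp.linearCombination ℝ W (π θ)).support,
        Finsupp.linearCombination ℝ W (π θ) e * f e =
      ∑ b ∈ (π θ).support, π θ b * Finsupp.linearCombination ℝ f (W b) := by
    have h := Finsupp.linearCombination_linearCombination ℝ f W (π θ)
    rwa [Finsupp.linearCombination_apply ℝ (Finsupp.linearCombination ℝ W (π θ)),
      Finsupp.linearCombination_apply ℝ (π θ)] at h
  have heq {f g : (Fin M → ℝ) → ℝ}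
      (hfg : ∀ b ∈ stdSimplex ℝ (Fin M), Finsupp.linearCombination ℝ f (W b) = g b) (θ : Fin K) :
      ∑ e ∈ (Finsupp.linearCombination ℝ W (π θ)).support,
        Finsupp.linearCombination ℝ W (π θ) e * f e = ∑ b ∈ (π θ).support, π θ b * g b := by
    rw [hcomb]
    exact Finset.sum_congr rfl fun b hb => by rw [hfg b ((hsig θ).2.1 hb)]
  have hsupp (θ : Fin K) :
      ((Finsupp.linearCombination ℝ W (π θ)).support : Set (Fin M → ℝ)) ⊆ XiHat F := by
    intro x hx
    rw [Finsupp.linearCombination_apply] at hx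
    obtain ⟨b, hb, hxb⟩ := Finset.mem_biUnion.1 (Finsupp.support_finsetSum hx)
    exact hWsupp b ((hsig θ).2.1 hb) (Finsupp.support_smul hxb)
  have hnonneg (θ : Fin K) : 0 ≤ Finsupp.linearCombination ℝ W (π θ) := by
    rw [Finsupp.linearCombination_apply]
    exact Finset.sum_nonneg fun b hb => smul_nonneg ((hsig θ).1 b) (hW0 b ((hsig θ).2.1 hb))
  refine ⟨fun θ => Finsupp.linearCombination ℝ W (π θ),
    ⟨⟨fun θ => ⟨hnonneg θ, fun x hx => ?_, ?_⟩, fun θ θ' i => ?_⟩, hsupp⟩, ?_, fun θhat θ => ?_⟩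
  · obtain ⟨js, hx⟩ := Set.mem_iUnion.1 (hsupp θ hx)
    exact ((mem_XiT hK).1 (extremePoints_subset hx)).1
  · simpa [(hsig θ).2.2] using heq (f := fun _ => 1) (g := fun _ => 1) hW1 θ
  · have hmean := heq (f := fun e => e i) (g := fun e => e i) fun b hb => hWmean b hb i
    rw [hmean, hmean, hcons θ θ' i]
  · funext θhat θ
    exact (heq (fun b hb => hWF b hb θ) θhat).symm
  · unfold Vsig
    rw [hcomb]
    exact Finset.sum_le_sum fun b hb =>
      mul_le_mul_of_nonneg_left (hWV b ((hsig θhat).2.1 hb) θ) ((hsig θhat).1 b)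

/-- Proposition 1: reduction of cumulative utility over a play horizon. -/
theorem sSup_cumulative_eq (M N K : ℕ) (hM : 0 < M) (hN : 0 < N) (hK : 0 < K)
    (L : Fin M → Fin N → ℝ) (F : Fin K → Fin M → Fin N → ℝ)
    (T : ℕ) (t : Fin T → Fin K) :
    sSup {x : ℝ | ∃ π ∈ SigSet M K, x = ∑ s : Fin T, Vsig L F π (psi F π (t s)) (t s)} =
      sSup {x : ℝ | ∃ π ∈ SigSetHat F, x = ∑ s : Fin T, Vsig L F π (psi F π (t s)) (t s)} := by
  refine csSup_eq_csSup_of_forall_exists_le ?_ ?_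
  · rintro _ ⟨π, hπ, rfl⟩
    obtain ⟨ρ, hρ, hU, hV⟩ := exists_hat_signaling hN hK L F hπ
    refine ⟨_, ⟨ρ, hρ, rfl⟩, Finset.sum_le_sum fun s _ => ?_⟩
    rw [psi_congr hU]
    exact hV _ _
  · rintro x ⟨ρ, hρ, rfl⟩
    exact ⟨_, ⟨ρ, hρ.1, rfl⟩, le_rfl⟩

end
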